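/- The bijective witness maps P into Q: for every p ∈ P, h p ∈ Q. -/

import Mathlib

def SB.Valid {α β : Type*} (P : Set α) (Q : Set β) : α ⊕ β → Prop
  | Sum.inl p => p ∈ P
  | Sum.inr q => q ∈ Q

def SB.step {α β : Type*} (f : α → β) (g : β → α) : α ⊕ β → α ⊕ β
  | Sum.inl p => Sum.inr (f p)
  | Sum.inr q => Sum.inl (g q)

def SB.ChainLE {α β : Type*} (f : α → β) (g : β → α) : α ⊕ β → α ⊕ β → Prop :=
  Relation.ReflTransGen (fun x y => y = SB.step f g x)

def SB.Initial {α β : Type*} (P : Set α) (Q : Set β) (f : α → β) (g : β → α) :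
    α ⊕ β → Prop
  | Sum.inl p => p ∉ g '' Q
  | Sum.inr q => q ∉ f '' P

def SB.InQStopper {α β : Type*} (P : Set α) (Q : Set β) (f : α → β) (g : β → α)
    (x : α ⊕ β) : Prop :=
  ∃ q ∈ Q, SB.Initial P Q f g (Sum.inr q) ∧ SB.ChainLE f g (Sum.inr q) x

open Classical in
noncomputable def SB.h {α β : Type*} (P : Set α) (Q : Set β) (f : α → β)
    (g : β → α) (p : α) : β :=
  if hq : SB.InQStopper P Q f g (Sum.inl p) then
    haveI : Nonempty β := ⟨hq.choose⟩
    Function.invFunOn g Q p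
  else f p

theorem SB.valid_of_chainLE {α β : Type*} {P : Set α} {Q : Set β} {f : α → β} {g : β → α}
    (hfm : Set.MapsTo f P Q) (hgm : Set.MapsTo g Q P) {x y : α ⊕ β}
    (hx : SB.Valid P Q x) (h : SB.ChainLE f g x y) : SB.Valid P Q y := by
  induction h with
  | refl => exact hx
  | @tail b c _ hbc ih =>
    subst hbc
    cases b with
    | inl p => exact hfm ih
    | inr q => exact hgm ih

theorem h_mapsTo {α β : Type*} (P : Set α) (Q : Set β)
    (f : α → β) (g : β → α)
    (hfm : Set.MapsTo f P Q) (hfi : Set.InjOn f P)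
    (hgm : Set.MapsTo g Q P) (hgi : Set.InjOn g Q) :
    Set.MapsTo (SB.h P Q f g) P Q := by
  intro p hp
  unfold SB.h
  split_ifs with hq
  · obtain ⟨q, hqQ, -, hle⟩ := id hq
    have hex : ∃ a ∈ Q, g a = p := by
      rcases Relation.ReflTransGen.cases_tail hle with h | ⟨b, hb, hbp⟩
      · cases h
      · have hv : SB.Valid P Q b := SB.valid_of_chainLE hfm hgm (x := Sum.inr q) hqQ hb
        cases b with
        | inl a => cases hbp
        | inr a => exact ⟨a, hv, (Sum.inl.inj hbp).symm⟩
    haveI : Nonempty β := ⟨q⟩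
    exact Function.invFunOn_mem hex
  · exact hfm hp
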